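/- (Theorem 1, upper bound.) Let M be an MDP with rewards bounded in [−Rmax, Rmax] and discount γ ∈ [0,1), let P̂ be an approximate transition kernel, let U be the set of α-unknown state-action pairs, and let M̂_p be the (α, Rmax)-pessimistic MDP built from P̂, U and an estimated initial distribution ρ̂0. Then for every policy π: J_{ρ̂0}(π, M̂_p) ≤ J_{ρ0}(π, M) + (2·Rmax/(1−γ))·D_TV(ρ0, ρ̂0) + (2·γ·Rmax/(1−γ)²)·α. -/

import Mathlib

open scoped ENNReal NNReal
open Classical

namespace MOReL

universe u v

variable {S : Type u} {A : Type v}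

/-- Distribution over trajectory prefixes `(s_0,a_0),…,(s_n,a_n)` generated by executing
policy `π` in the MDP with transition kernel `P` starting from `ρ0`. -/
noncomputable def pathPMF (ρ0 : PMF S) (π : S → PMF A) (P : S → A → PMF S) :
    (n : ℕ) → PMF (Fin (n + 1) → S × A)
  | 0 => ρ0.bind fun s => (π s).map fun a => fun _ => (s, a)
  | n + 1 =>
      (pathPMF ρ0 π P n).bind fun p =>
        (P (p (Fin.last n)).1 (p (Fin.last n)).2).bind fun s' =>
          (π s').map fun a' => Fin.snoc p (s', a')

/-- Marginal distribution of `(s_t, a_t)`. -/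
noncomputable def saDist (ρ0 : PMF S) (π : S → PMF A) (P : S → A → PMF S) (t : ℕ) :
    PMF (S × A) :=
  (pathPMF ρ0 π P t).map fun p => p (Fin.last t)

/-- Expectation of a real-valued function under a PMF. -/
noncomputable def pexp {α : Type*} (μ : PMF α) (f : α → ℝ) : ℝ :=
  ∑' x, (μ x).toReal * f x

/-- The value `J_{ρ0}(π, M) = E[∑_t γ^t r(s_t,a_t)]`. -/
noncomputable def J (ρ0 : PMF S) (π : S → PMF A) (P : S → A → PMF S) (γ : ℝ)
    (r : S → A → ℝ) : ℝ :=
  ∑' t : ℕ, γ ^ t * pexp (saDist ρ0 π P t) (fun sa => r sa.1 sa.2)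

/-- `P(T_V^π = t)`: the probability that the first visit of the executed trajectory to the
state-action set `V` occurs at time `t`. -/
noncomputable def hitProb (ρ0 : PMF S) (π : S → PMF A) (P : S → A → PMF S)
    (V : Set (S × A)) (t : ℕ) : ℝ≥0∞ :=
  (pathPMF ρ0 π P t).toOuterMeasure
    {p | p (Fin.last t) ∈ V ∧ ∀ i : Fin (t + 1), (i : ℕ) < t → p i ∉ V}

/-- `E[γ^{T_V^π}]`, with the convention `γ^∞ = 0`. -/
noncomputable def discHit (ρ0 : PMF S) (π : S → PMF A) (P : S → A → PMF S) (γ : ℝ)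
    (V : Set (S × A)) : ℝ :=
  ∑' t : ℕ, γ ^ t * (hitProb ρ0 π P V t).toReal

/-- Total variation distance between two PMFs. -/
noncomputable def DTV {α : Type*} (p q : PMF α) : ℝ :=
  (1 / 2) * ∑' x, |(p x).toReal - (q x).toReal|

/-- Discounted state-action visitation distribution `d^{π,M}(s,a)`. -/
noncomputable def dVisit (ρ0 : PMF S) (π : S → PMF A) (P : S → A → PMF S) (γ : ℝ)
    (sa : S × A) : ℝ :=
  (1 - γ) * ∑' t : ℕ, γ ^ t * ((saDist ρ0 π P t) sa).toReal

/-- `d^{π,M}(V)` for a set `V` of state-action pairs. -/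
noncomputable def dVisitSet (ρ0 : PMF S) (π : S → PMF A) (P : S → A → PMF S) (γ : ℝ)
    (V : Set (S × A)) : ℝ :=
  ∑' sa : V, dVisit ρ0 π P γ sa

/-- The set of `α`-unknown state-action pairs. -/
def unknown (P Phat : S → A → PMF S) (α : ℝ) : Set (S × A) :=
  {sa | α < DTV (Phat sa.1 sa.2) (P sa.1 sa.2)}

/-- Transition kernel of the pessimistic MDP on `Option S` (`none` is the absorbing state
HALT): unknown pairs and HALT transition to HALT, known pairs follow `Phat`. -/
noncomputable def pessKernel (Phat : S → A → PMF S) (U : Set (S × A)) :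
    Option S → A → PMF (Option S) := fun s a =>
  match s with
  | none => PMF.pure none
  | some s => if (s, a) ∈ U then PMF.pure none else (Phat s a).map some

/-- Reward of the pessimistic MDP: `-κ` at HALT and `r` elsewhere. -/
def pessReward (r : S → A → ℝ) (κ : ℝ) : Option S → A → ℝ := fun s a =>
  match s with
  | none => -κ
  | some s => r s a

/-- Extend a policy on `S` to `Option S` by an arbitrary action distribution at HALT
(the pessimistic value does not depend on this choice). -/
def extendPolicy (π : S → PMF A) (a0 : PMF A) : Option S → PMF A := fun s =>
  match s with
  | none => a0
  | some s => π s

end MOReL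

namespace MOReL

section Expectation

variable {α β : Type*}

theorem summable_toReal (μ : PMF α) : Summable fun x => (μ x).toReal :=
  ENNReal.summable_toReal μ.tsum_coe_ne_top

theorem tsum_toReal (μ : PMF α) : ∑' x, (μ x).toReal = 1 := by
  rw [← ENNReal.tsum_toReal_eq μ.apply_ne_top, μ.tsum_coe, ENNReal.toReal_one]

theorem summable_pexp (μ : PMF α) {f : α → ℝ} {C : ℝ} (hf : ∀ x, |f x| ≤ C) :
    Summable fun x => (μ x).toReal * f x := by
  refine Summable.of_norm_bounded ((summable_toReal μ).mul_right C) fun x => ?_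
  rw [Real.norm_eq_abs, abs_mul, abs_of_nonneg ENNReal.toReal_nonneg]
  exact mul_le_mul_of_nonneg_left (hf x) ENNReal.toReal_nonneg

theorem pexp_const (μ : PMF α) (c : ℝ) : pexp μ (fun _ => c) = c := by
  rw [pexp, tsum_mul_right, tsum_toReal, one_mul]

theorem pexp_mono (μ : PMF α) {f g : α → ℝ} {C D : ℝ} (hf : ∀ x, |f x| ≤ C)
    (hg : ∀ x, |g x| ≤ D) (h : ∀ x, f x ≤ g x) : pexp μ f ≤ pexp μ g :=
  (summable_pexp μ hf).tsum_le_tsum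
    (fun x => mul_le_mul_of_nonneg_left (h x) ENNReal.toReal_nonneg) (summable_pexp μ hg)

theorem pexp_add (μ : PMF α) {f g : α → ℝ} {C D : ℝ} (hf : ∀ x, |f x| ≤ C)
    (hg : ∀ x, |g x| ≤ D) : pexp μ (fun x => f x + g x) = pexp μ f + pexp μ g := by
  simp only [pexp, mul_add]
  exact (summable_pexp μ hf).tsum_add (summable_pexp μ hg)

theorem pexp_const_mul (μ : PMF α) (c : ℝ) (f : α → ℝ) :
    pexp μ (fun x => c * f x) = c * pexp μ f := by
  simp only [pexp, mul_left_comm _ c]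
  exact tsum_mul_left

theorem abs_pexp_le (μ : PMF α) {f : α → ℝ} {C : ℝ} (hf : ∀ x, |f x| ≤ C) :
    |pexp μ f| ≤ C := by
  have hC : ∀ c : ℝ, ∀ _ : α, |c| ≤ |c| := fun _ _ => le_rfl
  rw [abs_le]
  constructor
  · simpa only [pexp_const] using
      pexp_mono μ (hC (-C)) hf fun x => (abs_le.mp (hf x)).1
  · simpa only [pexp_const] using
      pexp_mono μ hf (hC C) fun x => (abs_le.mp (hf x)).2

theorem pexp_pure (a : α) (f : α → ℝ) : pexp (PMF.pure a) f = f a := by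
  rw [pexp, tsum_eq_single a]
  · simp
  · intro b hb
    simp [PMF.pure_apply, hb]

theorem pexp_bind (μ : PMF α) (k : α → PMF β) {f : β → ℝ} {C : ℝ} (hf : ∀ y, |f y| ≤ C) :
    pexp (μ.bind k) f = pexp μ fun x => pexp (k x) f := by
  have hsum : Summable fun z : α × β => (μ z.1 * k z.1 z.2).toReal := by
    refine ENNReal.summable_toReal ?_
    rw [ENNReal.tsum_prod']
    simp [ENNReal.tsum_mul_left, PMF.tsum_coe]
  have hsum' : Summable fun z : α × β => (μ z.1 * k z.1 z.2).toReal * f z.2 := by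
    refine Summable.of_norm_bounded (hsum.mul_right C) fun z => ?_
    rw [Real.norm_eq_abs, abs_mul, abs_of_nonneg ENNReal.toReal_nonneg]
    exact mul_le_mul_of_nonneg_left (hf z.2) ENNReal.toReal_nonneg
  have hcomm := Summable.tsum_comm (f := fun x y => (μ x * k x y).toReal * f y) hsum'
  calc pexp (μ.bind k) f = ∑' y, ∑' x, (μ x * k x y).toReal * f y := by
        refine tsum_congr fun y => ?_
        rw [PMF.bind_apply, ENNReal.tsum_toReal_eq, tsum_mul_right]
        exact fun x => ENNReal.mul_ne_top (μ.apply_ne_top x) ((k x).apply_ne_top y)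
    _ = ∑' x, ∑' y, (μ x * k x y).toReal * f y := hcomm
    _ = pexp μ fun x => pexp (k x) f := by
        refine tsum_congr fun x => ?_
        simp only [ENNReal.toReal_mul, mul_assoc, pexp]
        exact tsum_mul_left

theorem pexp_map (μ : PMF α) (g : α → β) {f : β → ℝ} {C : ℝ} (hf : ∀ y, |f y| ≤ C) :
    pexp (μ.map g) f = pexp μ fun x => f (g x) := by
  rw [← PMF.bind_pure_comp, pexp_bind μ _ hf]
  simp only [Function.comp_apply, pexp_pure]

theorem pexp_sub_pexp_le (p q : PMF α) {f : α → ℝ} {C : ℝ} (hf : ∀ x, |f x| ≤ C) :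
    pexp p f - pexp q f ≤ 2 * C * DTV p q := by
  have hpq : Summable fun x => |(p x).toReal - (q x).toReal| :=
    ((summable_toReal p).sub (summable_toReal q)).abs
  have hp := summable_pexp p hf
  have hq := summable_pexp q hf
  have h : ∑' x, ((p x).toReal * f x - (q x).toReal * f x)
      ≤ ∑' x, |(p x).toReal - (q x).toReal| * C := by
    refine (hp.sub hq).tsum_le_tsum (fun x => ?_) (hpq.mul_right C)
    rw [← sub_mul]
    refine (le_abs_self _).trans ?_
    rw [abs_mul]
    exact mul_le_mul_of_nonneg_left (hf x) (abs_nonneg _)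
  rw [hp.tsum_sub hq, tsum_mul_right] at h
  unfold pexp DTV
  linarith

theorem DTV_comm (p q : PMF α) : DTV p q = DTV q p := by
  simp only [DTV, abs_sub_comm]

end Expectation

section Value

variable {S : Type*} {A : Type*}

/-- Marginal distribution of the state `s_t`. -/
noncomputable def stateDist (ρ : PMF S) (π : S → PMF A) (P : S → A → PMF S) : ℕ → PMF S
  | 0 => ρ
  | t + 1 => (stateDist ρ π P t).bind fun s => (π s).bind fun a => P s a

theorem saDist_succ (ρ : PMF S) (π : S → PMF A) (P : S → A → PMF S) (t : ℕ) :
    saDist ρ π P (t + 1) = (saDist ρ π P t).bind fun sa =>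
      (P sa.1 sa.2).bind fun s => (π s).map fun a => (s, a) := by
  simp only [saDist, pathPMF, PMF.map_bind, PMF.bind_map, PMF.map_comp, Function.comp_def,
    Fin.snoc_last]

theorem saDist_eq_bind_stateDist (ρ : PMF S) (π : S → PMF A) (P : S → A → PMF S) (t : ℕ) :
    saDist ρ π P t = (stateDist ρ π P t).bind fun s => (π s).map fun a => (s, a) := by
  induction t with
  | zero => simp only [saDist, pathPMF, stateDist, PMF.map_bind, PMF.map_comp, Function.comp_def]
  | succ t ih =>
    simp only [saDist_succ, ih, stateDist, PMF.bind_bind, PMF.bind_map, Function.comp_def]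

/-- Expected discounted reward of `π` over the first `n` steps, started from a given state. -/
noncomputable def horizonValue (π : S → PMF A) (P : S → A → PMF S) (γ : ℝ) (r : S → A → ℝ) :
    ℕ → S → ℝ
  | 0, _ => 0
  | n + 1, s => pexp (π s) fun a => r s a + γ * pexp (P s a) (horizonValue π P γ r n)

variable {π : S → PMF A} {P : S → A → PMF S} {γ R : ℝ} {r : S → A → ℝ}

theorem geom_sum_le (hγ0 : 0 ≤ γ) (hγ1 : γ < 1) (n : ℕ) :
    ∑ t ∈ Finset.range n, γ ^ t ≤ 1 / (1 - γ) := by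
  rw [one_div, ← tsum_geometric_of_lt_one hγ0 hγ1]
  exact (summable_geometric_of_lt_one hγ0 hγ1).sum_le_tsum _ fun t _ => pow_nonneg hγ0 t

theorem geom_mul_le (hR : 0 ≤ R) (hγ0 : 0 ≤ γ) (hγ1 : γ < 1) (n : ℕ) :
    R * ∑ t ∈ Finset.range n, γ ^ t ≤ R / (1 - γ) := by
  rw [div_eq_mul_one_div]
  exact mul_le_mul_of_nonneg_left (geom_sum_le hγ0 hγ1 n) hR

theorem abs_add_discounted_le (hγ0 : 0 ≤ γ) {x y C D : ℝ} (hx : |x| ≤ C) (hy : |y| ≤ D) :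
    |x + γ * y| ≤ C + γ * D := by
  refine (abs_add_le _ _).trans (add_le_add hx ?_)
  rw [abs_mul, abs_of_nonneg hγ0]
  exact mul_le_mul_of_nonneg_left hy hγ0

theorem abs_horizonValue_le (hr : ∀ s a, |r s a| ≤ R) (hγ0 : 0 ≤ γ) (n : ℕ) (s : S) :
    |horizonValue π P γ r n s| ≤ R * ∑ t ∈ Finset.range n, γ ^ t := by
  induction n generalizing s with
  | zero => simp [horizonValue]
  | succ n ih =>
    have h : R * ∑ t ∈ Finset.range (n + 1), γ ^ t
        = R + γ * (R * ∑ t ∈ Finset.range n, γ ^ t) := by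
      rw [geom_sum_succ]; ring
    rw [h]
    exact abs_pexp_le _ fun a => abs_add_discounted_le hγ0 (hr s a) (abs_pexp_le _ ih)

theorem pexp_saDist (ρ : PMF S) (hr : ∀ s a, |r s a| ≤ R) (t : ℕ) :
    pexp (saDist ρ π P t) (fun sa => r sa.1 sa.2)
      = pexp (stateDist ρ π P t) fun s => pexp (π s) (r s) := by
  rw [saDist_eq_bind_stateDist, pexp_bind _ _ fun sa : S × A => hr sa.1 sa.2]
  congr 1
  funext s
  exact pexp_map _ _ fun sa : S × A => hr sa.1 sa.2

theorem pexp_stateDist_horizonValue_succ (ρ : PMF S) (hr : ∀ s a, |r s a| ≤ R) (hγ0 : 0 ≤ γ)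
    (t n : ℕ) :
    pexp (stateDist ρ π P t) (horizonValue π P γ r (n + 1))
      = pexp (saDist ρ π P t) (fun sa => r sa.1 sa.2)
        + γ * pexp (stateDist ρ π P (t + 1)) (horizonValue π P γ r n) := by
  have hV := abs_horizonValue_le (π := π) (P := P) hr hγ0 n
  set C := R * ∑ t ∈ Finset.range n, γ ^ t
  have hγPV : ∀ s a, |γ * pexp (P s a) (horizonValue π P γ r n)| ≤ γ * C := fun s a => by
    rw [abs_mul, abs_of_nonneg hγ0]
    exact mul_le_mul_of_nonneg_left (abs_pexp_le (P s a) hV) hγ0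
  have hstep : ∀ s, horizonValue π P γ r (n + 1) s
      = pexp (π s) (r s)
        + pexp (π s) fun a => γ * pexp (P s a) (horizonValue π P γ r n) :=
    fun s => pexp_add _ (hr s) (hγPV s)
  rw [pexp_saDist ρ hr, funext hstep, pexp_add _ (fun s => abs_pexp_le (π s) (hr s))
    fun s => abs_pexp_le (π s) (hγPV s)]
  simp only [stateDist, pexp_bind _ _ hV, pexp_const_mul]

theorem sum_add_pexp_horizonValue (ρ : PMF S) (hr : ∀ s a, |r s a| ≤ R) (hγ0 : 0 ≤ γ)
    (k n : ℕ) :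
    ∑ t ∈ Finset.range k, γ ^ t * pexp (saDist ρ π P t) (fun sa => r sa.1 sa.2)
        + γ ^ k * pexp (stateDist ρ π P k) (horizonValue π P γ r n)
      = pexp ρ (horizonValue π P γ r (n + k)) := by
  induction k generalizing n with
  | zero => simp [stateDist]
  | succ k ih =>
    rw [← add_assoc, add_right_comm, ← ih, pexp_stateDist_horizonValue_succ ρ hr hγ0,
      Finset.sum_range_succ]
    ring

theorem tendsto_pexp_horizonValue (ρ : PMF S) (hr : ∀ s a, |r s a| ≤ R) (hγ0 : 0 ≤ γ)
    (hγ1 : γ < 1) :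
    Filter.Tendsto (fun n => pexp ρ (horizonValue π P γ r n)) Filter.atTop
      (nhds (J ρ π P γ r)) := by
  have hsum : Summable fun t : ℕ =>
      γ ^ t * pexp (saDist ρ π P t) (fun sa => r sa.1 sa.2) := by
    refine Summable.of_norm_bounded
      ((summable_geometric_of_lt_one hγ0 hγ1).mul_right R) fun t => ?_
    rw [Real.norm_eq_abs, abs_mul, abs_of_nonneg (pow_nonneg hγ0 t)]
    exact mul_le_mul_of_nonneg_left (abs_pexp_le _ fun sa => hr sa.1 sa.2) (pow_nonneg hγ0 t)
  refine hsum.hasSum.tendsto_sum_nat.congr fun n => ?_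
  simpa [horizonValue, pexp] using sum_add_pexp_horizonValue (π := π) (P := P) ρ hr hγ0 n 0

end Value

section Pessimism

variable {S : Type*} {A : Type*} {π : S → PMF A} {P Phat : S → A → PMF S} {γ R α : ℝ}
  {r : S → A → ℝ}

theorem abs_pessReward_le (hR0 : 0 ≤ R) (hr : ∀ s a, |r s a| ≤ R) (s : Option S) (a : A) :
    |pessReward r R s a| ≤ R := by
  cases s with
  | none => simp [pessReward, abs_of_nonneg hR0]
  | some s => exact hr s a

theorem horizonValue_halt (a0 : PMF A) (U : Set (S × A)) (n : ℕ) :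
    horizonValue (extendPolicy π a0) (pessKernel Phat U) γ (pessReward r R) n none
      = -(R * ∑ t ∈ Finset.range n, γ ^ t) := by
  induction n with
  | zero => simp [horizonValue]
  | succ n ih =>
    simp only [horizonValue, pessReward, pessKernel, pexp_pure, ih, pexp_const]
    rw [geom_sum_succ]
    ring

theorem horizonValue_pess_le (hR0 : 0 ≤ R) (hr : ∀ s a, |r s a| ≤ R) (hγ0 : 0 ≤ γ)
    (hγ1 : γ < 1) (hα : 0 ≤ α) (a0 : PMF A) (n : ℕ) (s : S) :
    horizonValue (extendPolicy π a0) (pessKernel Phat (unknown P Phat α)) γ (pessReward r R) n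
        (some s)
      ≤ horizonValue π P γ r n s + 2 * γ * R / (1 - γ) ^ 2 * α := by
  have hγ : 0 < 1 - γ := sub_pos.mpr hγ1
  set c := 2 * γ * R / (1 - γ) ^ 2 * α with hc
  have hc0 : 0 ≤ c := by positivity
  induction n generalizing s with
  | zero => simpa [horizonValue] using hc0
  | succ n ih =>
    have hV := abs_horizonValue_le (π := π) (P := P) hr hγ0 n
    have hW := abs_horizonValue_le (π := extendPolicy π a0)
      (P := pessKernel Phat (unknown P Phat α)) (abs_pessReward_le hR0 hr) hγ0 n
    set V := horizonValue π P γ r n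
    set W := horizonValue (extendPolicy π a0) (pessKernel Phat (unknown P Phat α)) γ
      (pessReward r R) n with hWdef
    set G := R * ∑ t ∈ Finset.range n, γ ^ t
    have hcconst : ∀ _ : A, |c| ≤ |c| := fun _ => le_rfl
    have hQ : ∀ a, |r s a + γ * pexp (P s a) V| ≤ R + γ * G := fun a =>
      abs_add_discounted_le hγ0 (hr s a) (abs_pexp_le _ hV)
    have hstep : ∀ a, γ * pexp (pessKernel Phat (unknown P Phat α) (some s) a) W
        ≤ γ * pexp (P s a) V + c := by
      intro a
      by_cases hU : (s, a) ∈ unknown P Phat α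
      · have hle : pexp (pessKernel Phat (unknown P Phat α) (some s) a) W ≤ pexp (P s a) V := by
          simp only [pessKernel, hU, if_true, pexp_pure]
          rw [hWdef, horizonValue_halt]
          exact (abs_le.mp (abs_pexp_le (P s a) hV)).1
        linarith [mul_le_mul_of_nonneg_left hle hγ0]
      · have hD : DTV (Phat s a) (P s a) ≤ α := not_lt.mp hU
        have hmono : pexp (Phat s a) (fun x => W (some x)) ≤ pexp (Phat s a) V + c := by
          rw [← pexp_const (Phat s a) c, ← pexp_add _ hV fun _ => le_refl |c|]
          exact pexp_mono _ (fun x => hW (some x))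
            (fun x => (abs_add_le _ _).trans (add_le_add (hV x) le_rfl)) ih
        have hdiff := pexp_sub_pexp_le (Phat s a) (P s a)
          fun x => (hV x).trans (geom_mul_le hR0 hγ0 hγ1 n)
        have hdiff' : 2 * (R / (1 - γ)) * DTV (Phat s a) (P s a) ≤ 2 * (R / (1 - γ)) * α :=
          mul_le_mul_of_nonneg_left hD (by positivity)
        have hfix : γ * (c + 2 * (R / (1 - γ)) * α) = c := by
          rw [hc]
          field_simp
          ring
        have hle : pexp (pessKernel Phat (unknown P Phat α) (some s) a) W
            ≤ pexp (P s a) V + (c + 2 * (R / (1 - γ)) * α) := by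
          simp only [pessKernel, hU, if_false]
          rw [pexp_map _ _ hW]
          linarith
        linarith [mul_le_mul_of_nonneg_left hle hγ0]
    simp only [horizonValue]
    rw [← pexp_const (π s) c, ← pexp_add _ hQ hcconst]
    refine pexp_mono (π s)
      (fun a => abs_add_discounted_le hγ0 (abs_pessReward_le hR0 hr (some s) a)
        (abs_pexp_le _ hW))
      (fun a => (abs_add_le _ _).trans (add_le_add (hQ a) (hcconst a))) fun a => ?_
    have := hstep a
    simp only [pessReward]
    linarith

end Pessimism

/-- **Theorem 1 (upper bound).** For any policy, the value in the `(α, Rmax)`-pessimistic MDP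
never substantially over-estimates the value in the true MDP. -/
theorem pessimistic_value_upper_bound
    {S : Type u} {A : Type v} [Countable S] [Countable A]
    (P Phat : S → A → PMF S) (ρ0 ρhat : PMF S)
    (r : S → A → ℝ) (Rmax : ℝ) (hR : ∀ s a, |r s a| ≤ Rmax)
    (γ : ℝ) (hγ0 : 0 ≤ γ) (hγ1 : γ < 1)
    (α : ℝ) (hα : 0 ≤ α)
    (π : S → PMF A) (a0 : PMF A) :
    J (ρhat.map some) (extendPolicy π a0)
        (pessKernel Phat (unknown P Phat α)) γ (pessReward r Rmax)
      ≤ J ρ0 π P γ r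
        + (2 * Rmax / (1 - γ)) * DTV ρ0 ρhat
        + (2 * γ * Rmax / (1 - γ) ^ 2) * α := by
  have hR0 : 0 ≤ Rmax := by
    obtain ⟨s, -⟩ := ρ0.support_nonempty
    obtain ⟨a, -⟩ := (π s).support_nonempty
    exact (abs_nonneg _).trans (hR s a)
  have hγ : 0 < 1 - γ := sub_pos.mpr hγ1
  have hlim := tendsto_pexp_horizonValue (π := extendPolicy π a0)
    (P := pessKernel Phat (unknown P Phat α)) (ρhat.map some) (abs_pessReward_le hR0 hR) hγ0 hγ1
  have hlim' := ((tendsto_pexp_horizonValue (π := π) (P := P) ρ0 hR hγ0 hγ1).add_const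
    ((2 * Rmax / (1 - γ)) * DTV ρ0 ρhat)).add_const ((2 * γ * Rmax / (1 - γ) ^ 2) * α)
  refine le_of_tendsto_of_tendsto' hlim hlim' fun n => ?_
  have hV := abs_horizonValue_le (π := π) (P := P) hR hγ0 n
  have hW := abs_horizonValue_le (π := extendPolicy π a0)
    (P := pessKernel Phat (unknown P Phat α)) (abs_pessReward_le hR0 hR) hγ0 n
  have hmono := pexp_mono ρhat (fun s => hW (some s))
    (fun s => (abs_add_le _ _).trans (add_le_add (hV s) le_rfl))
    (horizonValue_pess_le hR0 hR hγ0 hγ1 hα a0 n)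
  rw [pexp_add _ hV (fun _ => le_rfl), pexp_const] at hmono
  have hdiff := pexp_sub_pexp_le ρhat ρ0 fun s => (hV s).trans (geom_mul_le hR0 hγ0 hγ1 n)
  rw [DTV_comm, ← mul_div_assoc] at hdiff
  rw [pexp_map _ _ hW]
  linarith

end MOReL
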